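/- arXiv:2505.04115 — 2 statements merged into one kernel-verified Lean document; each statement's English description precedes it below -/
import Mathlib

section
/- Sufficiency direction of the moment characterization (Theorem 2, corollary of Putinar): Let g_1,…,g_m and h_1,…,h_r be real polynomials in n variables and suppose the quadratic module M generated by g_1,…,g_m together with the ideal generated by h_1,…,h_r contains N − (x_1² + … + x_n²) for some real N (archimedean condition). Let L : ℝ[x_1,…,x_n] → ℝ be a linear functional with L(1) = 1, L(p²) ≥ 0 for every polynomial p, L(g_i·p²) ≥ 0 for every polynomial p and every i, and L(h_j·p) = 0 for every polynomial p and every j. Then there exists a probability measure μ on ℝ^n supported on the set K = {x ∈ ℝ^n : g_i(x) ≥ 0 for all i, h_j(x) = 0 for all j} such that L(p) = ∫ p dμ for every polynomial p. -/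
open MeasureTheory MvPolynomial

/-- A polynomial is a sum of squares if it is a finite sum of squares of polynomials. -/
def IsSOS {n : ℕ} (σ : MvPolynomial (Fin n) ℝ) : Prop :=
  ∃ (m : ℕ) (p : Fin m → MvPolynomial (Fin n) ℝ), σ = ∑ ℓ, (p ℓ) ^ 2

/-- Membership in the quadratic module generated by `g` together with the ideal
generated by `h`: expressions `σ₀ + Σ σᵢ gᵢ + Σ qⱼ hⱼ` with the `σ`'s SOS. -/
def InQMI {n m r : ℕ} (g : Fin m → MvPolynomial (Fin n) ℝ)
    (h : Fin r → MvPolynomial (Fin n) ℝ) (p : MvPolynomial (Fin n) ℝ) : Prop :=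
  ∃ (σ₀ : MvPolynomial (Fin n) ℝ) (σ : Fin m → MvPolynomial (Fin n) ℝ)
    (q : Fin r → MvPolynomial (Fin n) ℝ),
    IsSOS σ₀ ∧ (∀ i, IsSOS (σ i)) ∧ p = σ₀ + ∑ i, σ i * g i + ∑ j, q j * h j

section PositiveFunctional

variable {A : Type*} [CommRing A] [Algebra ℝ A]

/-- The Cauchy–Schwarz inequality for the positive semidefinite form `(a, b) ↦ L (w * a * b)`. -/
theorem sq_map_mul_mul_le {L : A →ₗ[ℝ] ℝ} {w : A} (hw : ∀ q, 0 ≤ L (w * q ^ 2)) (a b : A) :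
    L (w * a * b) ^ 2 ≤ L (w * a ^ 2) * L (w * b ^ 2) := by
  have key : ∀ x : ℝ,
      0 ≤ L (w * a ^ 2) * (x * x) + (2 * L (w * a * b)) * x + L (w * b ^ 2) := by
    intro x
    have h1 : w * (x • a + b) ^ 2
        = (x * x) • (w * a ^ 2) + (2 * x) • (w * a * b) + w * b ^ 2 := by
      simp only [Algebra.smul_def, map_mul, map_ofNat]
      ring
    have h2 := hw (x • a + b)
    rw [h1] at h2
    simp only [map_add, map_smul, smul_eq_mul] at h2
    linarith
  have := discrim_le_zero key
  rw [discrim] at this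
  linarith

/-- If multiplication by `f` and by `1 - f` is positive with respect to `L`, then multiplication
by `f` preserves positivity of elements. -/
theorem map_mul_mul_sq_nonneg {L : A →ₗ[ℝ] ℝ} (hL : ∀ q, 0 ≤ L (q ^ 2)) {f g : A}
    (hf : ∀ q, 0 ≤ L (f * q ^ 2)) (hf' : ∀ q, 0 ≤ L ((1 - f) * q ^ 2))
    (hg : ∀ q, 0 ≤ L (g * q ^ 2)) (q : A) : 0 ≤ L (f * g * q ^ 2) := by
  let u : ℕ → A := fun k => (fun a => a - a ^ 2)^[k] f
  have u_succ (k : ℕ) : u (k + 1) = u k - u k ^ 2 := Function.iterate_succ_apply' _ _ _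
  have hu (k : ℕ) : (∀ q, 0 ≤ L (u k * q ^ 2)) ∧ ∀ q, 0 ≤ L ((1 - u k) * q ^ 2) := by
    induction k with
    | zero => exact ⟨hf, hf'⟩
    | succ k ih =>
      refine ⟨fun q => ?_, fun q => ?_⟩
      · have : u (k + 1) * q ^ 2 = (1 - u k) * (u k * q) ^ 2 + u k * ((1 - u k) * q) ^ 2 := by
          rw [u_succ]; ring
        rw [this, map_add]
        exact add_nonneg (ih.2 _) (ih.1 _)
      · have : (1 - u (k + 1)) * q ^ 2 = (1 - u k) * q ^ 2 + (u k * q) ^ 2 := by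
          rw [u_succ]; ring
        rw [this, map_add]
        exact add_nonneg (ih.2 _) (hL _)
  have hsum (k : ℕ) : ∑ i ∈ Finset.range k, L ((u i * q) ^ 2) ≤ L (f * q ^ 2) := by
    have : ∑ i ∈ Finset.range k, L ((u i * q) ^ 2) = L (f * q ^ 2) - L (u k * q ^ 2) := by
      induction k with
      | zero => simp [u]
      | succ k ih =>
        have : u (k + 1) * q ^ 2 = u k * q ^ 2 - (u k * q) ^ 2 := by rw [u_succ]; ring
        rw [Finset.sum_range_succ, ih, this, map_sub]
        ring
    linarith [(hu k).1 q]
  have hlim : Filter.Tendsto (fun k => L ((u k * q) ^ 2)) Filter.atTop (nhds 0) :=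
    (summable_of_sum_range_le (fun _ => hL _) hsum).tendsto_atTop_zero
  have hge (k : ℕ) : L (u k * g * q ^ 2) ≤ L (f * g * q ^ 2) := by
    induction k with
    | zero => exact le_rfl
    | succ k ih =>
      have : u (k + 1) * g * q ^ 2 = u k * g * q ^ 2 - g * (u k * q) ^ 2 := by
        rw [u_succ]; ring
      rw [this, map_sub]
      linarith [hg (u k * q)]
  by_contra! hneg
  have hbound (k : ℕ) :
      L (f * g * q ^ 2) ^ 2 ≤ L ((u k * q) ^ 2) * L ((g * q) ^ 2) := by
    have h1 := sq_map_mul_mul_le (L := L) (w := 1) (by simpa using hL) (u k * q) (g * q)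
    have h2 : (1 : A) * (u k * q) * (g * q) = u k * g * q ^ 2 := by ring
    rw [h2, one_mul, one_mul] at h1
    nlinarith [hge k]
  have := ge_of_tendsto' (hlim.mul_const (L ((g * q) ^ 2))) hbound
  nlinarith

variable {ι κ : Type*}

/-- Normalized functionals that are nonnegative on squares and on the products of the `g i` with
squares, and vanish on the ideal generated by the `h j`. -/
structure IsMomentFunctional (g : ι → A) (h : κ → A) (L : A →ₗ[ℝ] ℝ) : Prop where
  map_one : L 1 = 1
  sq_nonneg : ∀ p, 0 ≤ L (p ^ 2)
  mul_sq_nonneg : ∀ i p, 0 ≤ L (g i * p ^ 2)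
  map_mul_eq_zero : ∀ j p, L (h j * p) = 0

/-- The moment functionals, as a set of real-valued functions. -/
def momentFunctionals (g : ι → A) (h : κ → A) : Set (A → ℝ) :=
  (fun L : A →ₗ[ℝ] ℝ => (L : A → ℝ)) '' {L | IsMomentFunctional g h L}

theorem convex_momentFunctionals (g : ι → A) (h : κ → A) :
    Convex ℝ (momentFunctionals g h) := by
  rintro _ ⟨L, hL, rfl⟩ _ ⟨L', hL', rfl⟩ a b ha hb hab
  refine ⟨a • L + b • L', ⟨?_, fun p => ?_, fun i p => ?_, fun j p => ?_⟩, rfl⟩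
  · simp [hL.map_one, hL'.map_one, hab]
  · have h1 := hL.sq_nonneg p
    have h2 := hL'.sq_nonneg p
    simp only [LinearMap.add_apply, LinearMap.smul_apply, smul_eq_mul]
    positivity
  · have h1 := hL.mul_sq_nonneg i p
    have h2 := hL'.mul_sq_nonneg i p
    simp only [LinearMap.add_apply, LinearMap.smul_apply, smul_eq_mul]
    positivity
  · simp [hL.map_mul_eq_zero, hL'.map_mul_eq_zero]

theorem isClosed_momentFunctionals (g : ι → A) (h : κ → A) :
    IsClosed (momentFunctionals g h) := by
  have : momentFunctionals g h = Set.range (fun L : A →ₗ[ℝ] ℝ => (L : A → ℝ)) ∩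
      ({φ | φ 1 = 1} ∩ (⋂ p, {φ | 0 ≤ φ (p ^ 2)}) ∩ (⋂ i, ⋂ p, {φ | 0 ≤ φ (g i * p ^ 2)}) ∩
        ⋂ j, ⋂ p, {φ | φ (h j * p) = 0}) := by
    ext φ
    simp only [momentFunctionals, Set.mem_image, Set.mem_inter_iff, Set.mem_range, Set.mem_iInter,
      Set.mem_ofPred_eq]
    constructor
    · rintro ⟨L, hL, rfl⟩
      exact ⟨⟨L, rfl⟩, ⟨⟨hL.map_one, hL.sq_nonneg⟩, hL.mul_sq_nonneg⟩, hL.map_mul_eq_zero⟩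
    · rintro ⟨⟨L, rfl⟩, ⟨⟨h1, h2⟩, h3⟩, h4⟩
      exact ⟨L, ⟨h1, h2, h3, h4⟩, rfl⟩
  rw [this]
  refine IsClosed.inter (LinearMap.isClosed_range_coe A ℝ (RingHom.id ℝ))
    (((IsClosed.inter ?_ ?_).inter ?_).inter ?_)
  · exact isClosed_eq (continuous_apply _) continuous_const
  · exact isClosed_iInter fun p => isClosed_le continuous_const (continuous_apply _)
  · exact isClosed_iInter fun i => isClosed_iInter fun p =>
      isClosed_le continuous_const (continuous_apply _)
  · exact isClosed_iInter fun i => isClosed_iInter fun p =>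
      isClosed_eq (continuous_apply _) continuous_const

/-- Multiplication by `p` is bounded, uniformly over all moment functionals. -/
def IsMomentBounded (g : ι → A) (h : κ → A) (p : A) : Prop :=
  ∃ c : ℝ, 0 ≤ c ∧ ∀ L, IsMomentFunctional g h L → ∀ q, L (p ^ 2 * q ^ 2) ≤ c * L (q ^ 2)

theorem IsMomentBounded.algebraMap (g : ι → A) (h : κ → A) (a : ℝ) :
    IsMomentBounded g h (algebraMap ℝ A a) := by
  refine ⟨a ^ 2, _root_.sq_nonneg a, fun L hL q => le_of_eq ?_⟩
  rw [← map_pow, ← Algebra.smul_def, map_smul, smul_eq_mul]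

theorem IsMomentBounded.add {g : ι → A} {h : κ → A} {p p' : A} (hp : IsMomentBounded g h p)
    (hp' : IsMomentBounded g h p') : IsMomentBounded g h (p + p') := by
  obtain ⟨c, hc, H⟩ := hp
  obtain ⟨c', hc', H'⟩ := hp'
  refine ⟨2 * c + 2 * c', by positivity, fun L hL q => ?_⟩
  have h1 : (p + p') ^ 2 * q ^ 2 + ((p - p') * q) ^ 2
      = (2 : ℝ) • (p ^ 2 * q ^ 2) + (2 : ℝ) • (p' ^ 2 * q ^ 2) := by
    simp only [Algebra.smul_def, map_ofNat]
    ring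
  have h2 := congrArg L h1
  simp only [map_add, map_smul, smul_eq_mul] at h2
  linarith [H L hL q, H' L hL q, hL.sq_nonneg ((p - p') * q)]

theorem IsMomentBounded.mul {g : ι → A} {h : κ → A} {p p' : A} (hp : IsMomentBounded g h p)
    (hp' : IsMomentBounded g h p') : IsMomentBounded g h (p * p') := by
  obtain ⟨c, hc, H⟩ := hp
  obtain ⟨c', hc', H'⟩ := hp'
  refine ⟨c * c', by positivity, fun L hL q => ?_⟩
  calc L ((p * p') ^ 2 * q ^ 2) = L (p ^ 2 * (p' * q) ^ 2) := by congr 1; ring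
    _ ≤ c * L ((p' * q) ^ 2) := H L hL _
    _ = c * L (p' ^ 2 * q ^ 2) := by rw [mul_pow]
    _ ≤ c * (c' * L (q ^ 2)) := by gcongr; exact H' L hL q
    _ = c * c' * L (q ^ 2) := by ring

theorem isCompact_momentFunctionals {g : ι → A} {h : κ → A}
    (hb : ∀ p, IsMomentBounded g h p) : IsCompact (momentFunctionals g h) := by
  choose c hc H using hb
  refine (isCompact_univ_pi fun p => isCompact_Icc (a := -(c p + 1))
    (b := c p + 1)).of_isClosed_subset (isClosed_momentFunctionals g h) ?_
  rintro _ ⟨L, hL, rfl⟩ p -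
  have h1 := H p L hL 1
  have h2 := hL.sq_nonneg (p + 1)
  have h3 := hL.sq_nonneg (p - 1)
  have e2 : (p + 1) ^ 2 = p ^ 2 + (2 : ℝ) • p + 1 := by
    simp only [Algebra.smul_def, map_ofNat]; ring
  have e3 : (p - 1) ^ 2 = p ^ 2 - (2 : ℝ) • p + 1 := by
    simp only [Algebra.smul_def, map_ofNat]; ring
  rw [e2] at h2
  rw [e3] at h3
  simp only [one_pow, mul_one, map_add, map_sub, map_smul, smul_eq_mul, hL.map_one] at h1 h2 h3
  have := hc p
  constructor <;> simp only <;> linarith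

/-- Restricting a moment functional to a density strictly between `0` and `1` gives, after
normalization, a moment functional. -/
theorem IsMomentFunctional.withDensity {g : ι → A} {h : κ → A} {L : A →ₗ[ℝ] ℝ}
    (hL : IsMomentFunctional g h L) {f : A} (hf : ∀ q, 0 ≤ L (f * q ^ 2))
    (hf' : ∀ q, 0 ≤ L ((1 - f) * q ^ 2)) (hpos : 0 < L f) :
    IsMomentFunctional g h ((L f)⁻¹ • L ∘ₗ LinearMap.mulLeft ℝ f) := by
  refine ⟨?_, fun p => ?_, fun i p => ?_, fun j p => ?_⟩
  · simp [hpos.ne']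
  · exact mul_nonneg (inv_nonneg.2 hpos.le) (hf p)
  · refine mul_nonneg (inv_nonneg.2 hpos.le) ?_
    have := map_mul_mul_sq_nonneg hL.sq_nonneg hf hf' (hL.mul_sq_nonneg i) p
    rwa [mul_assoc] at this
  · simp [mul_left_comm f, hL.map_mul_eq_zero]

theorem map_mul_of_mem_extremePoints {g : ι → A} {h : κ → A} (hb : ∀ p, IsMomentBounded g h p)
    {L : A →ₗ[ℝ] ℝ} (hL : (L : A → ℝ) ∈ (momentFunctionals g h).extremePoints ℝ) (p q : A) :
    L (p * q) = L p * L q := by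
  have hLm : IsMomentFunctional g h L := by
    obtain ⟨L', hL', e⟩ := hL.1
    rwa [← DFunLike.coe_injective e]
  obtain ⟨c, hc, H⟩ := hb p
  set ε : ℝ := (2 * (c + 1))⁻¹ with hε
  have hεpos : 0 < ε := by positivity
  set f : A := algebraMap ℝ A (1 / 2) + ε • p with hfdef
  have hLf (a : A) : L (f * a) = 1 / 2 * L a + ε * L (p * a) := by
    rw [hfdef, add_mul, map_add, ← Algebra.smul_def, map_smul, smul_mul_assoc, map_smul]
    rfl
  have hpb (a : A) : |ε * L (p * a ^ 2)| ≤ 1 / 4 * L (a ^ 2) := by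
    have h1 := H L hLm a
    have h2 := hLm.sq_nonneg ((p + 1) * a)
    have h3 := hLm.sq_nonneg ((p - 1) * a)
    have e2 : ((p + 1) * a) ^ 2 = p ^ 2 * a ^ 2 + (2 : ℝ) • (p * a ^ 2) + a ^ 2 := by
      simp only [Algebra.smul_def, map_ofNat]; ring
    have e3 : ((p - 1) * a) ^ 2 = p ^ 2 * a ^ 2 - (2 : ℝ) • (p * a ^ 2) + a ^ 2 := by
      simp only [Algebra.smul_def, map_ofNat]; ring
    rw [e2] at h2
    rw [e3] at h3
    simp only [map_add, map_sub, map_smul, smul_eq_mul] at h2 h3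
    have h4 : |L (p * a ^ 2)| ≤ (c + 1) / 2 * L (a ^ 2) := by
      rw [abs_le]; constructor <;> linarith
    rw [abs_mul, abs_of_pos hεpos]
    calc ε * |L (p * a ^ 2)| ≤ ε * ((c + 1) / 2 * L (a ^ 2)) := by gcongr
      _ = 1 / 4 * L (a ^ 2) := by rw [hε]; field_simp; ring
  have hf (a : A) : 0 ≤ L (f * a ^ 2) := by
    rw [hLf]
    linarith [(abs_le.1 (hpb a)).1, hLm.sq_nonneg a]
  have hf' (a : A) : 0 ≤ L ((1 - f) * a ^ 2) := by
    rw [sub_mul, one_mul, map_sub, hLf]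
    linarith [(abs_le.1 (hpb a)).2, hLm.sq_nonneg a]
  have hLf1 : L f = 1 / 2 + ε * L p := by simpa [hLm.map_one] using hLf 1
  have hpb1 : |ε * L p| ≤ 1 / 4 := by simpa [hLm.map_one] using hpb 1
  have hpos : 0 < L f := by linarith [(abs_le.1 hpb1).1]
  have hsub : L (1 - f) = 1 - L f := by rw [map_sub, hLm.map_one]
  have hpos' : 0 < L (1 - f) := by linarith [(abs_le.1 hpb1).2]
  have h1 := hLm.withDensity hf hf' hpos
  have h2 := hLm.withDensity hf' (by simpa using hf) hpos'
  have key := hL.2 ⟨_, h1, rfl⟩ ⟨_, h2, rfl⟩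
    ⟨L f, L (1 - f), hpos, hpos', by rw [hsub]; ring, by
      ext a
      simp only [LinearMap.coe_smul, LinearMap.coe_comp, Pi.add_apply, Pi.smul_apply,
        Function.comp_apply, LinearMap.mulLeft_apply, smul_eq_mul]
      rw [mul_inv_cancel_left₀ hpos.ne', mul_inv_cancel_left₀ hpos'.ne', ← map_add]
      congr 1
      ring⟩
  have key' := congrFun key q
  simp only [LinearMap.coe_smul, LinearMap.coe_comp, Pi.smul_apply,
    Function.comp_apply, LinearMap.mulLeft_apply, smul_eq_mul] at key'
  rw [inv_mul_eq_iff_eq_mul₀ hpos.ne', hLf, hLf1] at key'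
  refine mul_left_cancel₀ hεpos.ne' ?_
  linarith

end PositiveFunctional

/-- On a compact space, every limit of convex combinations of point evaluations is given by
integration against a probability measure. -/
theorem exists_probabilityMeasure_of_mem_closure_convexHull {K ι : Type*} [TopologicalSpace K]
    [CompactSpace K] [T2Space K] [MeasurableSpace K] [BorelSpace K] (f : ι → C(K, ℝ))
    {φ : ι → ℝ} (hφ : φ ∈ closure (convexHull ℝ (Set.range fun x i => f i x))) :
    ∃ ν : ProbabilityMeasure K, ∀ i, φ i = ∫ x, f i x ∂(ν : Measure K) := by
  let Φ : ProbabilityMeasure K → ι → ℝ := fun ν i => ∫ x, f i x ∂(ν : Measure K)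
  have hint (ν : Measure K) [IsFiniteMeasure ν] (i : ι) : Integrable (f i) ν :=
    (BoundedContinuousFunction.mkOfCompact (f i)).integrable ν
  have hcont : Continuous Φ := by
    refine continuous_pi fun i => continuous_iff_continuousAt.2 fun ν => ?_
    exact ProbabilityMeasure.tendsto_iff_forall_integral_tendsto.1 Filter.tendsto_id
      (BoundedContinuousFunction.mkOfCompact (f i))
  have hconv : Convex ℝ (Set.range Φ) := by
    rintro _ ⟨ν, rfl⟩ _ ⟨ν', rfl⟩ a b ha hb hab
    have hprob : IsProbabilityMeasure
        (ENNReal.ofReal a • (ν : Measure K) + ENNReal.ofReal b • (ν' : Measure K)) := by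
      constructor
      simp [← ENNReal.ofReal_add ha hb, hab]
    refine ⟨⟨_, hprob⟩, ?_⟩
    ext i
    simp only [Φ, ProbabilityMeasure.coe_mk, Pi.add_apply, Pi.smul_apply]
    rw [integral_add_measure ((hint _ i).smul_measure ENNReal.ofReal_ne_top)
      ((hint _ i).smul_measure ENNReal.ofReal_ne_top), integral_smul_measure,
      integral_smul_measure, ENNReal.toReal_ofReal ha, ENNReal.toReal_ofReal hb]
  have hsub : (Set.range fun x i => f i x) ⊆ Set.range Φ := by
    rintro _ ⟨x, rfl⟩
    refine ⟨⟨Measure.dirac x, inferInstance⟩, ?_⟩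
    ext i
    simp [Φ]
  obtain ⟨ν, hν⟩ := closure_minimal (convexHull_min hsub hconv)
    (isCompact_range hcont).isClosed hφ
  exact ⟨ν, fun i => (congrFun hν i).symm⟩

section Archimedean

variable {n m r : ℕ} {g : Fin m → MvPolynomial (Fin n) ℝ} {h : Fin r → MvPolynomial (Fin n) ℝ}

theorem IsMomentFunctional.map_mul_sq_nonneg_of_inQMI {L : MvPolynomial (Fin n) ℝ →ₗ[ℝ] ℝ}
    (hL : IsMomentFunctional g h L) {p : MvPolynomial (Fin n) ℝ} (hp : InQMI g h p)
    (q : MvPolynomial (Fin n) ℝ) : 0 ≤ L (p * q ^ 2) := by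
  obtain ⟨σ₀, σ, s, ⟨k, a, rfl⟩, hσ, rfl⟩ := hp
  rw [add_mul, add_mul, map_add, map_add, Finset.sum_mul, Finset.sum_mul, Finset.sum_mul,
    map_sum, map_sum, map_sum]
  refine add_nonneg (add_nonneg ?_ ?_) ?_
  · exact Finset.sum_nonneg fun i _ => by rw [← mul_pow]; exact hL.sq_nonneg _
  · refine Finset.sum_nonneg fun i _ => ?_
    obtain ⟨k, b, hb⟩ := hσ i
    rw [hb, Finset.sum_mul, Finset.sum_mul, map_sum]
    refine Finset.sum_nonneg fun l _ => ?_
    have : b l ^ 2 * g i * q ^ 2 = g i * (b l * q) ^ 2 := by ring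
    rw [this]
    exact hL.mul_sq_nonneg i _
  · refine Finset.sum_nonneg fun j _ => ?_
    have : s j * h j * q ^ 2 = h j * (s j * q ^ 2) := by ring
    rw [this, hL.map_mul_eq_zero]

theorem isMomentBounded_of_archimedean {N : ℝ}
    (hN : InQMI g h (C N - ∑ s, (X s : MvPolynomial (Fin n) ℝ) ^ 2))
    (p : MvPolynomial (Fin n) ℝ) : IsMomentBounded g h p := by
  have hX (s : Fin n) : IsMomentBounded g h (X s) := by
    refine ⟨|N|, abs_nonneg N, fun L hL q => ?_⟩
    have h1 := hL.map_mul_sq_nonneg_of_inQMI hN q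
    rw [sub_mul, map_sub, C_mul', map_smul, smul_eq_mul, Finset.sum_mul, map_sum] at h1
    have h2 := Finset.single_le_sum (f := fun t => L (X t ^ 2 * q ^ 2))
      (fun t _ => by rw [← mul_pow]; exact hL.sq_nonneg _) (Finset.mem_univ s)
    have h3 := mul_le_mul_of_nonneg_right (le_abs_self N) (hL.sq_nonneg q)
    linarith
  induction p using MvPolynomial.induction_on with
  | C a => exact .algebraMap g h a
  | add p q hp hq => exact hp.add hq
  | mul_X p s hp => exact hp.mul (hX s)

/-- The basic closed semialgebraic set cut out by `g ≥ 0` and `h = 0`. -/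
def semialgebraicSet (g : Fin m → MvPolynomial (Fin n) ℝ) (h : Fin r → MvPolynomial (Fin n) ℝ) :
    Set (Fin n → ℝ) :=
  {x | (∀ i, 0 ≤ eval x (g i)) ∧ ∀ j, eval x (h j) = 0}

theorem isMomentFunctional_eval {x : Fin n → ℝ} (hx : x ∈ semialgebraicSet g h) :
    IsMomentFunctional g h (aeval x : MvPolynomial (Fin n) ℝ →ₐ[ℝ] ℝ).toLinearMap := by
  refine ⟨by simp, fun p => ?_, fun i p => ?_, fun j p => ?_⟩
  · simpa using sq_nonneg _
  · simpa [coe_aeval_eq_eval] using mul_nonneg (hx.1 i) (sq_nonneg _)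
  · simp [hx.2 j]

theorem isClosed_semialgebraicSet (g : Fin m → MvPolynomial (Fin n) ℝ)
    (h : Fin r → MvPolynomial (Fin n) ℝ) : IsClosed (semialgebraicSet g h) := by
  simp only [semialgebraicSet, Set.ofPred_and, Set.ofPred_forall]
  exact (isClosed_iInter fun i => isClosed_le continuous_const (continuous_eval _)).inter
    (isClosed_iInter fun j => isClosed_eq (continuous_eval _) continuous_const)

theorem isCompact_semialgebraicSet (hb : ∀ p, IsMomentBounded g h p) :
    IsCompact (semialgebraicSet g h) := by
  choose c hc H using hb
  refine (isCompact_univ_pi fun s => isCompact_Icc (a := -(c (X s) + 1))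
    (b := c (X s) + 1)).of_isClosed_subset (isClosed_semialgebraicSet g h) ?_
  intro x hx s _
  have := H (X s) _ (isMomentFunctional_eval hx) 1
  simp only [AlgHom.toLinearMap_apply, map_pow, aeval_X, map_one, one_pow, mul_one] at this
  constructor <;> nlinarith

theorem exists_eval_of_mem_extremePoints (hb : ∀ p, IsMomentBounded g h p)
    {φ : MvPolynomial (Fin n) ℝ → ℝ} (hφ : φ ∈ (momentFunctionals g h).extremePoints ℝ) :
    ∃ x ∈ semialgebraicSet g h, ∀ p, φ p = eval x p := by
  obtain ⟨L, hL, rfl⟩ := hφ.1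
  have heval : ∀ p, L p = eval (fun s => L (X s)) p := fun p =>
    DFunLike.congr_fun (f := AlgHom.ofLinearMap L hL.map_one (map_mul_of_mem_extremePoints hb hφ))
      (g := aeval fun s => L (X s)) (by ext s; simp) p
  refine ⟨fun s => L (X s), ⟨fun i => ?_, fun j => ?_⟩, heval⟩
  · rw [← heval]
    simpa using hL.mul_sq_nonneg i 1
  · rw [← heval]
    simpa using hL.map_mul_eq_zero j 1

end Archimedean

/-- Sufficiency direction of the moment characterization (corollary of Putinar):
under the archimedean condition, a linear functional satisfying the moment conditions
is represented by a probability measure supported on the constraint set. -/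
theorem moment_characterization_sufficiency {n m r : ℕ}
    (g : Fin m → MvPolynomial (Fin n) ℝ) (h : Fin r → MvPolynomial (Fin n) ℝ)
    (harch : ∃ N : ℝ, InQMI g h (C N - ∑ s, (X s : MvPolynomial (Fin n) ℝ) ^ 2))
    (L : MvPolynomial (Fin n) ℝ →ₗ[ℝ] ℝ)
    (hL1 : L 1 = 1)
    (hLsq : ∀ p : MvPolynomial (Fin n) ℝ, 0 ≤ L (p ^ 2))
    (hLg : ∀ (i : Fin m) (p : MvPolynomial (Fin n) ℝ), 0 ≤ L (g i * p ^ 2))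
    (hLh : ∀ (j : Fin r) (p : MvPolynomial (Fin n) ℝ), L (h j * p) = 0) :
    ∃ μ : Measure (Fin n → ℝ), IsProbabilityMeasure μ ∧
      μ {x | ¬ ((∀ i, 0 ≤ eval x (g i)) ∧ (∀ j, eval x (h j) = 0))} = 0 ∧
      ∀ p : MvPolynomial (Fin n) ℝ,
        Integrable (fun x => eval x p) μ ∧ L p = ∫ x, eval x p ∂μ := by
  obtain ⟨N, hN⟩ := harch
  have hb := isMomentBounded_of_archimedean hN
  have hK := isCompact_semialgebraicSet hb
  have hKm : MeasurableSet (semialgebraicSet g h) := hK.measurableSet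
  have : CompactSpace (semialgebraicSet g h) := isCompact_iff_compactSpace.1 hK
  let f : MvPolynomial (Fin n) ℝ → C(semialgebraicSet g h, ℝ) := fun p =>
    ⟨fun x => eval (x : Fin n → ℝ) p, (continuous_eval p).comp continuous_subtype_val⟩
  have hmem : (L : MvPolynomial (Fin n) ℝ → ℝ) ∈
      closure (convexHull ℝ (Set.range fun x p => f p x)) := by
    have hL : (L : MvPolynomial (Fin n) ℝ → ℝ) ∈ momentFunctionals g h :=
      ⟨L, ⟨hL1, hLsq, hLg, hLh⟩, rfl⟩
    rw [← closure_convexHull_extremePoints (isCompact_momentFunctionals hb)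
      (convex_momentFunctionals g h)] at hL
    refine closure_mono (convexHull_mono fun φ hφ => ?_) hL
    obtain ⟨x, hx, hφx⟩ := exists_eval_of_mem_extremePoints hb hφ
    exact ⟨⟨x, hx⟩, funext fun p => (hφx p).symm⟩
  obtain ⟨ν, hν⟩ := exists_probabilityMeasure_of_mem_closure_convexHull f hmem
  have hemb : MeasurableEmbedding (Subtype.val : semialgebraicSet g h → Fin n → ℝ) :=
    .subtype_coe hKm
  refine ⟨(ν : Measure (semialgebraicSet g h)).map Subtype.val,
    Measure.isProbabilityMeasure_map measurable_subtype_coe.aemeasurable, ?_, fun p => ⟨?_, ?_⟩⟩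
  · rw [hemb.map_apply]
    convert! measure_empty (μ := (ν : Measure (semialgebraicSet g h)))
    exact Set.eq_empty_of_forall_notMem fun x hx => hx x.2
  · rw [hemb.integrable_map_iff]
    exact (BoundedContinuousFunction.mkOfCompact (f p)).integrable _
  · rw [hemb.integral_map, hν]
    rfl
end

section
/- Putinar's Positivstellensatz: Let g_1,…,g_m ∈ ℝ[x_1,…,x_n] and let M = {σ_0 + Σ_{i=1}^m σ_i·g_i : σ_0,…,σ_m sums of squares} be the quadratic module they generate. Suppose M is archimedean, i.e., there is a real N with N − (x_1² + … + x_n²) ∈ M. If a polynomial p ∈ ℝ[x_1,…,x_n] satisfies p(x) > 0 for every x in K = {x ∈ ℝ^n : g_i(x) ≥ 0 for all i = 1,…,m}, then p ∈ M. -/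
open MvPolynomial

/-- Membership in the quadratic module generated by `g₁, …, g_m`:
expressions `σ₀ + Σ σᵢ gᵢ` with the `σ`'s sums of squares. -/
def InQM {n m : ℕ} (g : Fin m → MvPolynomial (Fin n) ℝ)
    (p : MvPolynomial (Fin n) ℝ) : Prop :=
  ∃ (σ₀ : MvPolynomial (Fin n) ℝ) (σ : Fin m → MvPolynomial (Fin n) ℝ),
    IsSOS σ₀ ∧ (∀ i, IsSOS (σ i)) ∧ p = σ₀ + ∑ i, σ i * g i

section QuadraticModule

variable {A : Type*} [CommRing A] {Q : Set A}

/-- A quadratic module of a commutative ring. -/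
structure IsQuadraticModule (Q : Set A) : Prop where
  one_mem : 1 ∈ Q
  add_mem : ∀ {a b}, a ∈ Q → b ∈ Q → a + b ∈ Q
  sq_mul_mem : ∀ a {b}, b ∈ Q → a ^ 2 * b ∈ Q

/-- The elements `q + s * f` with `q ∈ Q` and `s` a sum of squares. -/
def adjoinElement (Q : Set A) (f : A) : Set A :=
  {a | ∃ q ∈ Q, ∃ s, IsSumSq s ∧ a = q + s * f}

namespace IsQuadraticModule

theorem sq_mem (hQ : IsQuadraticModule Q) (a : A) : a ^ 2 ∈ Q := by
  simpa using hQ.sq_mul_mem a hQ.one_mem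

theorem zero_mem (hQ : IsQuadraticModule Q) : (0 : A) ∈ Q := by
  simpa using hQ.sq_mem 0

theorem isQuadraticModule_adjoinElement (hQ : IsQuadraticModule Q) (f : A) :
    IsQuadraticModule (adjoinElement Q f) where
  one_mem := ⟨1, hQ.one_mem, 0, .zero, by simp⟩
  add_mem := by
    rintro _ _ ⟨q, hq, s, hs, rfl⟩ ⟨q', hq', s', hs', rfl⟩
    exact ⟨q + q', hQ.add_mem hq hq', s + s', hs.add hs', by ring⟩
  sq_mul_mem := by
    rintro a _ ⟨q, hq, s, hs, rfl⟩
    refine ⟨a ^ 2 * q, hQ.sq_mul_mem a hq, a * a * s, (IsSumSq.mul_self a).mul hs, by ring⟩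

theorem subset_adjoinElement (Q : Set A) (f : A) : Q ⊆ adjoinElement Q f :=
  fun q hq => ⟨q, hq, 0, .zero, by simp⟩

theorem sumSq_mul_mem (hQ : IsQuadraticModule Q) {s : A} (hs : IsSumSq s) {a : A} (ha : a ∈ Q) :
    s * a ∈ Q := by
  induction hs with
  | zero => simpa using hQ.zero_mem
  | sq_add b _ ih =>
    rw [add_mul, ← sq]
    exact hQ.add_mem (hQ.sq_mul_mem b ha) ih

theorem sumSq_mem (hQ : IsQuadraticModule Q) {s : A} (hs : IsSumSq s) : s ∈ Q := by
  simpa using hQ.sumSq_mul_mem hs hQ.one_mem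

theorem self_mem_adjoinElement (hQ : IsQuadraticModule Q) (f : A) :
    f ∈ adjoinElement Q f :=
  ⟨0, hQ.zero_mem, 1, .one, by simp⟩

/-- Every proper quadratic module is contained in a maximal one. -/
theorem exists_maximal (hQ : IsQuadraticModule Q) (h1 : (-1 : A) ∉ Q) :
    ∃ P, Q ⊆ P ∧ Maximal (fun P : Set A => IsQuadraticModule P ∧ -1 ∉ P) P := by
  refine zorn_subset_nonempty {P : Set A | IsQuadraticModule P ∧ -1 ∉ P} ?_ Q ⟨hQ, h1⟩
  intro c hc hchain hne
  refine ⟨⋃₀ c, ⟨⟨?_, ?_, ?_⟩, ?_⟩, fun s hs => Set.subset_sUnion_of_mem hs⟩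
  · obtain ⟨P, hP⟩ := hne
    exact ⟨P, hP, (hc hP).1.one_mem⟩
  · rintro a b ⟨P, hP, ha⟩ ⟨P', hP', hb⟩
    rcases hchain.total hP hP' with h | h
    · exact ⟨P', hP', (hc hP').1.add_mem (h ha) hb⟩
    · exact ⟨P, hP, (hc hP).1.add_mem ha (h hb)⟩
  · rintro a b ⟨P, hP, hb⟩
    exact ⟨P, hP, (hc hP).1.sq_mul_mem a hb⟩
  · rintro ⟨P, hP, h⟩
    exact (hc hP).2 h

end IsQuadraticModule

variable [Algebra ℝ A]

local notation "κ" => algebraMap ℝ A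

/-- A subset of a real algebra is archimedean if every element is bounded above by a real
number with respect to it. -/
def IsArchimedeanModule (Q : Set A) : Prop := ∀ f : A, ∃ N : ℝ, κ N - f ∈ Q

/-- `f` lies between `-r` and `r` with respect to `Q`. -/
def BoundedBy (Q : Set A) (f : A) (r : ℝ) : Prop := κ r - f ∈ Q ∧ κ r + f ∈ Q

namespace IsQuadraticModule

theorem algebraMap_mul_mem (hQ : IsQuadraticModule Q) {r : ℝ} (hr : 0 ≤ r) {a : A} (ha : a ∈ Q) :
    κ r * a ∈ Q := by
  have h := hQ.sq_mul_mem (κ √r) ha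
  rwa [← map_pow, Real.sq_sqrt hr] at h

theorem algebraMap_mem (hQ : IsQuadraticModule Q) {r : ℝ} (hr : 0 ≤ r) : κ r ∈ Q := by
  simpa using hQ.algebraMap_mul_mem hr hQ.one_mem

theorem mem_of_algebraMap_mul_mem (hQ : IsQuadraticModule Q) {r : ℝ} (hr : 0 < r) {a : A}
    (ha : κ r * a ∈ Q) : a ∈ Q := by
  have h := hQ.algebraMap_mul_mem (inv_nonneg.2 hr.le) ha
  rwa [← mul_assoc, ← map_mul, inv_mul_cancel₀ hr.ne', map_one, one_mul] at h

theorem nonneg_of_algebraMap_mem (hQ : IsQuadraticModule Q) (h1 : (-1 : A) ∉ Q) {r : ℝ}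
    (hr : κ r ∈ Q) : 0 ≤ r := by
  by_contra! h
  refine h1 (hQ.mem_of_algebraMap_mul_mem (neg_pos.2 h) ?_)
  simpa using hr

/-- The support of a quadratic module absorbs multiplication. -/
theorem mul_mem_of_mem_of_neg_mem (hQ : IsQuadraticModule Q) {a : A} (ha : a ∈ Q)
    (hna : -a ∈ Q) (f : A) : f * a ∈ Q := by
  have h := hQ.add_mem (hQ.sq_mul_mem (f + 1) ha) (hQ.sq_mul_mem (f - 1) hna)
  refine hQ.mem_of_algebraMap_mul_mem (r := 4) (by norm_num) ?_
  convert h using 1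
  rw [map_ofNat]
  ring

theorem boundedBy_add (hQ : IsQuadraticModule Q) {f g : A} {r t : ℝ} (hf : BoundedBy Q f r)
    (hg : BoundedBy Q g t) : BoundedBy Q (f + g) (r + t) := by
  constructor
  · convert hQ.add_mem hf.1 hg.1 using 1
    rw [map_add]; ring
  · convert hQ.add_mem hf.2 hg.2 using 1
    rw [map_add]; ring

theorem boundedBy_algebraMap_mul (hQ : IsQuadraticModule Q) {f : A} {r : ℝ}
    (hf : BoundedBy Q f r) (c : ℝ) : BoundedBy Q (κ c * f) (|c| * r) := by
  rcases le_total 0 c with hc | hc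
  · rw [abs_of_nonneg hc]
    constructor
    · convert hQ.algebraMap_mul_mem hc hf.1 using 1
      rw [map_mul]; ring
    · convert hQ.algebraMap_mul_mem hc hf.2 using 1
      rw [map_mul]; ring
  · rw [abs_of_nonpos hc]
    constructor
    · convert hQ.algebraMap_mul_mem (neg_nonneg.2 hc) hf.2 using 1
      rw [map_mul, map_neg]; ring
    · convert hQ.algebraMap_mul_mem (neg_nonneg.2 hc) hf.1 using 1
      rw [map_mul, map_neg]; ring

theorem boundedBy_mono (hQ : IsQuadraticModule Q) {f : A} {r t : ℝ} (hf : BoundedBy Q f r)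
    (hrt : r ≤ t) : BoundedBy Q f t := by
  have h := hQ.algebraMap_mem (sub_nonneg.2 hrt)
  rw [map_sub] at h
  constructor
  · convert hQ.add_mem hf.1 h using 1
    ring
  · convert hQ.add_mem hf.2 h using 1
    ring

theorem sq_sub_sq_mem (hQ : IsQuadraticModule Q) {f : A} {r : ℝ} (hr : 0 < r)
    (hf : BoundedBy Q f r) : κ r ^ 2 - f ^ 2 ∈ Q := by
  refine hQ.mem_of_algebraMap_mul_mem (r := 2 * r) (by positivity) ?_
  convert hQ.add_mem (hQ.sq_mul_mem (κ r - f) hf.2) (hQ.sq_mul_mem (κ r + f) hf.1) using 1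
  rw [map_mul, map_ofNat]
  ring

theorem boundedBy_mul (hQ : IsQuadraticModule Q) {f g : A} {r : ℝ} (hr : 0 < r)
    (hf : BoundedBy Q f r) (hg : BoundedBy Q g r) : BoundedBy Q (f * g) (r ^ 2) := by
  have key : ∀ {u : A}, BoundedBy Q u r → κ (r ^ 2) - f * u ∈ Q := by
    intro u hu
    have h := hQ.sq_sub_sq_mem (by positivity) (hQ.boundedBy_add hf hu)
    refine hQ.mem_of_algebraMap_mul_mem (r := 4) (by norm_num) ?_
    convert hQ.add_mem h (hQ.sq_mem (f - u)) using 1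
    simp only [map_add, map_pow, map_ofNat]
    ring
  refine ⟨key hg, ?_⟩
  have hng : BoundedBy Q (-g) r := by
    simpa only [BoundedBy, sub_neg_eq_add, ← sub_eq_add_neg] using hg.symm
  simpa using key hng

/-- A maximal proper quadratic module is a semiordering. -/
theorem mem_or_neg_mem_of_maximal
    (hQ : Maximal (fun P : Set A => IsQuadraticModule P ∧ -1 ∉ P) Q) (f : A) :
    f ∈ Q ∨ -f ∈ Q := by
  have hq := hQ.prop.1
  have key : ∀ g : A, g ∉ Q → -1 ∈ adjoinElement Q g := by
    intro g hg
    by_contra h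
    exact hg (hQ.le_of_ge ⟨hq.isQuadraticModule_adjoinElement g, h⟩ (subset_adjoinElement Q g)
      (hq.self_mem_adjoinElement g))
  by_contra! h
  obtain ⟨q, hqm, s, hs, e⟩ := key f h.1
  obtain ⟨q', hqm', s', hs', e'⟩ := key (-f) h.2
  have hneg : -s ∈ Q := by
    have := hq.add_mem (hq.sumSq_mem hs')
      (hq.add_mem (hq.sumSq_mul_mem hs hqm') (hq.sumSq_mul_mem hs' hqm))
    convert this using 1
    linear_combination s' * e + s * e'
  refine hQ.prop.2 (e ▸ hq.add_mem hqm ?_)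
  rw [mul_comm]
  exact hq.mul_mem_of_mem_of_neg_mem (hq.sumSq_mem hs) hneg f

/-- With respect to a maximal archimedean quadratic module, every element is infinitesimally
close to a real number. -/
theorem exists_boundedBy_sub_of_maximal
    (hQ : Maximal (fun P : Set A => IsQuadraticModule P ∧ -1 ∉ P) Q)
    (harch : IsArchimedeanModule Q) (f : A) :
    ∃ c : ℝ, ∀ ε > 0, BoundedBy Q (f - κ c) ε := by
  have hq := hQ.prop.1
  set S : Set ℝ := {r | f - κ r ∈ Q} with hS
  have hne : S.Nonempty := by
    obtain ⟨N, hN⟩ := harch (-f)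
    refine ⟨-N, ?_⟩
    simpa [hS, add_comm] using hN
  have hbdd : BddAbove S := by
    obtain ⟨N, hN⟩ := harch f
    refine ⟨N, fun r hr => ?_⟩
    have h := hq.add_mem hN hr
    rw [sub_add_sub_cancel, ← map_sub] at h
    exact sub_nonneg.1 (hq.nonneg_of_algebraMap_mem hQ.prop.2 h)
  refine ⟨sSup S, fun ε hε => ⟨?_, ?_⟩⟩
  · have h : sSup S + ε ∉ S := fun h => by linarith [le_csSup hbdd h]
    convert (mem_or_neg_mem_of_maximal hQ (f - κ (sSup S + ε))).resolve_left h using 1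
    rw [map_add]; ring
  · obtain ⟨r, hr, hlt⟩ := exists_lt_of_lt_csSup hne (sub_lt_self (sSup S) hε)
    convert hq.add_mem hr (hq.algebraMap_mem (r := r - (sSup S - ε)) (by linarith)) using 1
    simp only [map_sub]; ring

/-- The real number infinitesimally close to a given element is unique. -/
theorem eq_zero_of_boundedBy (hQ : IsQuadraticModule Q) (h1 : (-1 : A) ∉ Q) {c : ℝ}
    (hc : ∀ ε > 0, BoundedBy Q (κ c) ε) : c = 0 := by
  refine le_antisymm (le_of_forall_pos_le_add fun ε hε => ?_)
    (le_of_forall_pos_le_add fun ε hε => ?_)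
  · have h := (hc ε hε).1
    rw [← map_sub] at h
    linarith [hQ.nonneg_of_algebraMap_mem h1 h]
  · have h := (hc ε hε).2
    rw [← map_add] at h
    linarith [hQ.nonneg_of_algebraMap_mem h1 h]

/-- A proper archimedean quadratic module is nonnegative under some real character. -/
theorem exists_algHom_nonneg (hM : IsQuadraticModule Q) (h1 : (-1 : A) ∉ Q)
    (harch : IsArchimedeanModule Q) : ∃ φ : A →ₐ[ℝ] ℝ, ∀ a ∈ Q, 0 ≤ φ a := by
  obtain ⟨P, hQP, hP⟩ := hM.exists_maximal h1
  have hq := hP.prop.1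
  have hPa : IsArchimedeanModule P := fun f => (harch f).imp fun N hN => hQP hN
  choose c hc using exists_boundedBy_sub_of_maximal hP hPa
  have huniq : ∀ f r, (∀ ε > 0, BoundedBy P (f - κ r) ε) → c f = r := by
    intro f r h
    refine sub_eq_zero.1 (hq.eq_zero_of_boundedBy hP.prop.2 fun ε hε => ?_)
    convert hq.boundedBy_mono (hq.boundedBy_add (h (ε / 2) (half_pos hε))
      (hq.boundedBy_algebraMap_mul (hc f (ε / 2) (half_pos hε)) (-1)))
      (show ε / 2 + |(-1 : ℝ)| * (ε / 2) ≤ ε by norm_num) using 1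
    simp only [map_sub, map_neg, map_one]; ring
  have hcomm : ∀ r : ℝ, c (κ r) = r := fun r => huniq _ _ fun ε hε => by
    simpa [BoundedBy] using hq.algebraMap_mem hε.le
  have hadd : ∀ f g, c (f + g) = c f + c g := fun f g => huniq _ _ fun ε hε => by
    convert hq.boundedBy_add (hc f (ε / 2) (half_pos hε)) (hc g (ε / 2) (half_pos hε)) using 1
    · rw [map_add]; ring
    · ring
  have hsmul : ∀ (f : A) (r ε : ℝ), 0 < ε → (∀ ε > 0, BoundedBy P f ε) →
      BoundedBy P (κ r * f) ε := by
    intro f r ε hε hf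
    refine hq.boundedBy_mono (hq.boundedBy_algebraMap_mul (hf (ε / (|r| + 1)) (by positivity)) r) ?_
    rw [← mul_div_assoc, div_le_iff₀ (by positivity)]
    nlinarith [abs_nonneg r]
  have hmul : ∀ f g, c (f * g) = c f * c g := fun f g => huniq _ _ fun ε hε => by
    have h3 : 0 < ε / 3 := by positivity
    have hs : 0 < √(ε / 3) := Real.sqrt_pos.2 h3
    convert hq.boundedBy_add (hq.boundedBy_add
      (hq.boundedBy_mul hs (hc f _ hs) (hc g _ hs)) (hsmul _ (c f) _ h3 (hc g)))
      (hsmul _ (c g) _ h3 (hc f)) using 1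
    · rw [map_mul]; ring
    · rw [Real.sq_sqrt h3.le]; ring
  refine ⟨{ toFun := c, map_one' := ?_, map_mul' := hmul, map_zero' := ?_, map_add' := hadd,
            commutes' := hcomm }, fun a ha => ?_⟩
  · simpa using hcomm 1
  · simpa using hcomm 0
  · refine le_of_forall_pos_le_add fun ε hε => ?_
    have h := hq.add_mem (hc a ε hε).1 (hQP ha)
    rw [sub_sub_eq_add_sub, sub_add_cancel, ← map_add] at h
    change 0 ≤ c a + ε
    linarith [hq.nonneg_of_algebraMap_mem hP.prop.2 h]

/-- If `s * p - 1` lies in an archimedean quadratic module for a sum of squares `s`, so does `p`. -/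
theorem mem_of_sumSq_mul_sub_one_mem (hQ : IsQuadraticModule Q) (harch : IsArchimedeanModule Q)
    {s p : A} (hs : IsSumSq s) (h : s * p - 1 ∈ Q) : p ∈ Q := by
  obtain ⟨a, ha⟩ := harch s
  obtain ⟨b, hb⟩ := harch (s ^ 2 * p + 1)
  obtain ⟨N, hN⟩ := harch (-p)
  have raise : ∀ {x y : ℝ} {f : A}, x ≤ y → κ x - f ∈ Q → κ y - f ∈ Q := by
    intro x y f hxy hx
    convert hQ.add_mem hx (hQ.algebraMap_mem (sub_nonneg.2 hxy)) using 1
    rw [map_sub]; ring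
  set k : ℝ := max 1 (max a b) with hk
  have hk1 : 1 ≤ k := le_max_left _ _
  have hka : a ≤ 2 * k := by linarith [le_max_left a b, le_max_right 1 (max a b)]
  have hkb : b ≤ 2 * k := by linarith [le_max_right a b, le_max_right 1 (max a b)]
  have hk0 : 0 < k := by linarith
  have h1 := raise hka ha
  have h2 := raise hkb hb
  have hkk : κ (k ^ 2) * κ (1 / k ^ 2) = 1 := by
    rw [← map_mul, mul_one_div_cancel (by positivity), map_one]
  have step : ∀ r : ℝ, 0 ≤ r → p + κ r + κ (1 / k ^ 2) ∈ Q → p + κ r ∈ Q := by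
    intro r hr hp
    have hr' : 0 ≤ r + 1 / k ^ 2 := by positivity
    refine hQ.mem_of_algebraMap_mul_mem (r := k ^ 2) (by positivity) ?_
    convert hQ.add_mem (hQ.add_mem (hQ.add_mem (hQ.sq_mul_mem (κ k - s) hp)
      (hQ.algebraMap_mul_mem (r := 2 * k) (by positivity) h))
      (hQ.algebraMap_mul_mem hr' (hQ.sumSq_mul_mem hs h1))) h2 using 1
    simp only [map_add, map_mul, map_pow, map_ofNat] at hkk ⊢
    linear_combination -hkk
  have iter : ∀ j : ℕ, p + κ (j * (1 / k ^ 2)) ∈ Q → p ∈ Q := by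
    intro j
    induction j with
    | zero => simp
    | succ j ih =>
      intro hj
      refine ih (step _ (by positivity) ?_)
      convert hj using 1
      rw [add_assoc, ← map_add]
      congr 2
      push_cast
      ring
  obtain ⟨j, hj⟩ := exists_nat_ge (N * k ^ 2)
  refine iter j ?_
  have := raise (y := j * (1 / k ^ 2)) (by rw [mul_one_div, le_div_iff₀ (by positivity)]; exact hj) hN
  rwa [sub_neg_eq_add, add_comm] at this

/-- **Jacobi's representation theorem**: an element that is positive at every real character
which is nonnegative on an archimedean quadratic module lies in this module. -/
theorem mem_of_forall_algHom_pos (hQ : IsQuadraticModule Q) (harch : IsArchimedeanModule Q)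
    {p : A} (hp : ∀ φ : A →ₐ[ℝ] ℝ, (∀ a ∈ Q, 0 ≤ φ a) → 0 < φ p) : p ∈ Q := by
  have hsub := subset_adjoinElement Q (-p)
  by_cases h1 : (-1 : A) ∈ adjoinElement Q (-p)
  · obtain ⟨q, hq, s, hs, e⟩ := h1
    refine hQ.mem_of_sumSq_mul_sub_one_mem harch hs ?_
    convert hq using 1
    linear_combination e
  · obtain ⟨φ, hφ⟩ := (hQ.isQuadraticModule_adjoinElement (-p)).exists_algHom_nonneg h1
      fun f => (harch f).imp fun N hN => hsub hN
    have h := hφ _ (hQ.self_mem_adjoinElement (-p))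
    rw [map_neg] at h
    linarith [hp φ fun a ha => hφ a (hsub ha)]

end IsQuadraticModule
end QuadraticModule

section Polynomial

variable {n m : ℕ}

theorem isSOS_iff_isSumSq (σ : MvPolynomial (Fin n) ℝ) : IsSOS σ ↔ IsSumSq σ := by
  constructor
  · rintro ⟨k, q, rfl⟩
    exact IsSumSq.sum_sq _ _
  · intro h
    induction h with
    | zero => exact ⟨0, Fin.elim0, by simp⟩
    | sq_add a _ ih =>
      obtain ⟨k, q, rfl⟩ := ih
      exact ⟨k + 1, Fin.cons a q, by simp [Fin.sum_univ_succ, sq]⟩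

theorem isQuadraticModule_setOf_inQM (g : Fin m → MvPolynomial (Fin n) ℝ) :
    IsQuadraticModule {p | InQM g p} where
  one_mem := by
    refine ⟨1, 0, ?_, fun i => ?_, by simp⟩ <;> rw [isSOS_iff_isSumSq]
    exacts [.one, .zero]
  add_mem := by
    rintro _ _ ⟨σ, τ, hσ, hτ, rfl⟩ ⟨σ', τ', hσ', hτ', rfl⟩
    simp only [isSOS_iff_isSumSq] at hσ hτ hσ' hτ'
    refine ⟨σ + σ', τ + τ', ?_, fun i => ?_, ?_⟩
    · rw [isSOS_iff_isSumSq]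
      exact hσ.add hσ'
    · rw [isSOS_iff_isSumSq]
      exact (hτ i).add (hτ' i)
    · simp only [Pi.add_apply, add_mul, Finset.sum_add_distrib]
      ring
  sq_mul_mem := by
    rintro a _ ⟨σ, τ, hσ, hτ, rfl⟩
    simp only [isSOS_iff_isSumSq] at hσ hτ
    refine ⟨a * a * σ, fun i => a * a * τ i, ?_, fun i => ?_, ?_⟩
    · rw [isSOS_iff_isSumSq]
      exact (IsSumSq.mul_self a).mul hσ
    · rw [isSOS_iff_isSumSq]
      exact (IsSumSq.mul_self a).mul (hτ i)
    · simp only [mul_add, Finset.mul_sum, sq, mul_assoc]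

theorem generator_inQM (g : Fin m → MvPolynomial (Fin n) ℝ) (i : Fin m) : InQM g (g i) := by
  refine ⟨0, Pi.single i 1, ?_, fun j => ?_, ?_⟩
  · rw [isSOS_iff_isSumSq]
    exact .zero
  · rw [isSOS_iff_isSumSq]
    rcases eq_or_ne j i with rfl | h
    · simp
    · simp [h]
  · simp [Pi.single_apply]

/-- A quadratic module of polynomials is archimedean once it bounds the sum of the squares of
the variables. -/
theorem IsQuadraticModule.isArchimedeanModule_of_sum_sq {Q : Set (MvPolynomial (Fin n) ℝ)}
    (hQ : IsQuadraticModule Q) {N : ℝ}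
    (hN : C N - ∑ s, (X s : MvPolynomial (Fin n) ℝ) ^ 2 ∈ Q) : IsArchimedeanModule Q := by
  have hX : ∀ i, BoundedBy Q (X i : MvPolynomial (Fin n) ℝ) (N + 1 / 4) := by
    intro i
    have hsum : ∑ s ∈ Finset.univ.erase i, (X s : MvPolynomial (Fin n) ℝ) ^ 2 ∈ Q :=
      hQ.sumSq_mem (IsSumSq.sum_sq _ _)
    have hi := hQ.add_mem hN hsum
    rw [← Finset.add_sum_erase _ _ (Finset.mem_univ i)] at hi
    have h4 : (C (1 / 2) : MvPolynomial (Fin n) ℝ) * 2 = 1 := by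
      rw [← map_ofNat C 2, ← map_mul]
      norm_num
    have h5 : (C (1 / 4) : MvPolynomial (Fin n) ℝ) = C (1 / 2) ^ 2 := by
      rw [← map_pow]
      norm_num
    constructor
    · convert hQ.add_mem hi (hQ.sq_mem (X i - C (1 / 2))) using 1
      rw [algebraMap_eq, map_add, h5]
      linear_combination X i * h4
    · convert hQ.add_mem hi (hQ.sq_mem (X i + C (1 / 2))) using 1
      rw [algebraMap_eq, map_add, h5]
      linear_combination -X i * h4
  have key : ∀ f : MvPolynomial (Fin n) ℝ, ∃ r, BoundedBy Q f r := by
    intro f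
    induction f using MvPolynomial.induction_on with
    | C a =>
      refine ⟨|a|, ?_, ?_⟩
      · rw [algebraMap_eq, ← map_sub]
        exact hQ.algebraMap_mem (sub_nonneg.2 (le_abs_self a))
      · rw [algebraMap_eq, ← map_add]
        exact hQ.algebraMap_mem (by linarith [neg_abs_le a])
    | add f g hf hg =>
      obtain ⟨r, hr⟩ := hf
      obtain ⟨t, ht⟩ := hg
      exact ⟨_, hQ.boundedBy_add hr ht⟩
    | mul_X f i hf =>
      obtain ⟨r, hr⟩ := hf
      have h0 : 0 < max 1 (max r (N + 1 / 4)) := lt_of_lt_of_le one_pos (le_max_left _ _)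
      exact ⟨_, hQ.boundedBy_mul h0
        (hQ.boundedBy_mono hr ((le_max_left _ _).trans (le_max_right _ _)))
        (hQ.boundedBy_mono (hX i) ((le_max_right _ _).trans (le_max_right _ _)))⟩
  exact fun f => (key f).imp fun r hr => hr.1

end Polynomial

/-- Putinar's Positivstellensatz: if the quadratic module generated by the `gᵢ` is
archimedean, then every polynomial strictly positive on the constraint set
`K = {x : gᵢ(x) ≥ 0 ∀ i}` belongs to the quadratic module. -/
theorem putinar_positivstellensatz {n m : ℕ}
    (g : Fin m → MvPolynomial (Fin n) ℝ)
    (harch : ∃ N : ℝ, InQM g (C N - ∑ s, (X s : MvPolynomial (Fin n) ℝ) ^ 2))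
    (p : MvPolynomial (Fin n) ℝ)
    (hpos : ∀ x : Fin n → ℝ, (∀ i, 0 ≤ eval x (g i)) → 0 < eval x p) :
    InQM g p := by
  have hQ := isQuadraticModule_setOf_inQM g
  obtain ⟨N, hN⟩ := harch
  refine hQ.mem_of_forall_algHom_pos (hQ.isArchimedeanModule_of_sum_sq hN) fun φ hφ => ?_
  have heval : ∀ q, φ q = eval (fun i => φ (X i)) q := fun q => by
    rw [← coe_aeval_eq_eval, RingHom.coe_coe]
    exact DFunLike.congr_fun (aeval_unique φ) q
  rw [heval]
  refine hpos _ fun i => ?_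
  rw [← heval]
  exact hφ _ (generator_inQM g i)
end
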